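/- arXiv:2107.14713 — 5 statements merged into one kernel-verified Lean document; each statement's English description precedes it below -/
import Mathlib

section
/- Let H be a crown-free linear 3-graph on n vertices such that H has no edge e with D(e) ≥ (4,4,3) and no edge e with D(e) ≥ (5,4,2) (coordinatewise). Then the number of edges of H is at most 3n/2. -/
/-- `E` is (the edge set of) a linear 3-graph: every edge has 3 vertices and
any two distinct edges intersect in at most one vertex. -/
def LinearTripleSystem {V : Type*} [DecidableEq V] (E : Finset (Finset V)) : Prop :=
  (∀ e ∈ E, e.card = 3) ∧ ∀ e ∈ E, ∀ f ∈ E, e ≠ f → (e ∩ f).card ≤ 1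

/-- `E` contains a crown: three pairwise disjoint edges (jewels) together with a
base edge intersecting all three jewels. -/
def HasCrown {V : Type*} [DecidableEq V] (E : Finset (Finset V)) : Prop :=
  ∃ base ∈ E, ∃ j1 ∈ E, ∃ j2 ∈ E, ∃ j3 ∈ E,
    Disjoint j1 j2 ∧ Disjoint j1 j3 ∧ Disjoint j2 j3 ∧
    (base ∩ j1).Nonempty ∧ (base ∩ j2).Nonempty ∧ (base ∩ j3).Nonempty

/-- The degree of a vertex: the number of edges containing it. -/
def degree {V : Type*} [DecidableEq V] (E : Finset (Finset V)) (v : V) : ℕ :=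
  (E.filter (fun e => v ∈ e)).card

/-- `E` has an edge `{a,b,c}` whose degree vector, sorted in non-increasing order,
dominates `(p,q,r)` coordinatewise (for a non-increasing pattern `p ≥ q ≥ r` this is
equivalent to the existence of a labelling as below). -/
def HasEdgeWithDegreesAtLeast {V : Type*} [DecidableEq V] (E : Finset (Finset V))
    (p q r : ℕ) : Prop :=
  ∃ a b c : V, a ≠ b ∧ a ≠ c ∧ b ≠ c ∧ ({a, b, c} : Finset V) ∈ E ∧
    p ≤ degree E a ∧ q ≤ degree E b ∧ r ≤ degree E c

/-- The reciprocals of three positive integers sum to at least `2 / 3` unless the sorted triple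
dominates `(4, 4, 3)` or `(5, 4, 2)`. -/
theorem two_thirds_le_sum_inv_of_sorted {p q r : ℕ} (hr : 0 < r) (hrq : r ≤ q) (hqp : q ≤ p)
    (h443 : ¬ (4 ≤ p ∧ 4 ≤ q ∧ 3 ≤ r)) (h542 : ¬ (5 ≤ p ∧ 4 ≤ q ∧ 2 ≤ r)) :
    (2 / 3 : ℚ) ≤ (p : ℚ)⁻¹ + (q : ℚ)⁻¹ + (r : ℚ)⁻¹ := by
  have hp0 : (0 : ℚ) ≤ (p : ℚ)⁻¹ := by positivity
  have hq0 : (0 : ℚ) ≤ (q : ℚ)⁻¹ := by positivity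
  have inv_bound : ∀ k m : ℕ, 0 < k → k ≤ m → (m : ℚ)⁻¹ ≤ (k : ℚ)⁻¹ := fun k m hk hkm =>
    inv_anti₀ (by exact_mod_cast hk) (by exact_mod_cast hkm)
  obtain rfl | h2 | h3 : r = 1 ∨ r = 2 ∨ 3 ≤ r := by omega
  · norm_num
    linarith
  · subst h2
    by_cases hq : q ≤ 3
    · have := inv_bound q 3 (by omega) hq
      norm_num at this ⊢
      linarith
    · have hp := inv_bound p 4 (by omega) (by omega)
      have hq := inv_bound q 4 (by omega) (by omega)
      norm_num at hp hq ⊢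
      linarith
  · obtain ⟨rfl, rfl⟩ : q = 3 ∧ r = 3 := by omega
    norm_num
    linarith

/-- In an edge dominating neither `(4, 4, 3)` nor `(5, 4, 2)`, the reciprocals of the degrees sum
to at least `2 / 3`. -/
theorem two_thirds_le_sum_inv_degree {V : Type*} [DecidableEq V] {E : Finset (Finset V)}
    (h443 : ¬ HasEdgeWithDegreesAtLeast E 4 4 3) (h542 : ¬ HasEdgeWithDegreesAtLeast E 5 4 2)
    {e : Finset V} (he : e ∈ E) (hcard : e.card = 3) :
    (2 / 3 : ℚ) ≤ ∑ v ∈ e, (degree E v : ℚ)⁻¹ := by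
  have sorted : ∀ a b c : V, a ≠ b → a ≠ c → b ≠ c → e = {a, b, c} →
      degree E b ≤ degree E a → degree E c ≤ degree E b →
      (2 / 3 : ℚ) ≤ ∑ v ∈ e, (degree E v : ℚ)⁻¹ := by
    intro a b c hab hac hbc habc hba hcb
    have hc : 0 < degree E c := Finset.card_pos.mpr ⟨e, Finset.mem_filter.mpr ⟨he, by simp [habc]⟩⟩
    have hsum := two_thirds_le_sum_inv_of_sorted hc hcb hba
      (fun h => h443 ⟨a, b, c, hab, hac, hbc, habc ▸ he, h⟩)
      (fun h => h542 ⟨a, b, c, hab, hac, hbc, habc ▸ he, h⟩)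
    rw [habc, Finset.sum_insert (by simp [hab, hac]), Finset.sum_pair hbc]
    linarith
  obtain ⟨a, b, c, hab, hac, hbc, habc⟩ := Finset.card_eq_three.mp hcard
  rcases le_total (degree E a) (degree E b) with h1 | h1 <;>
  rcases le_total (degree E a) (degree E c) with h2 | h2 <;>
  rcases le_total (degree E b) (degree E c) with h3 | h3
  · exact sorted c b a hbc.symm hac.symm hab.symm (by grind) h3 h1
  · exact sorted b c a hbc hab.symm hac.symm (by grind) h3 h2
  · exact sorted b a c hab.symm hbc hac (by grind) h1 h2
  · exact sorted b a c hab.symm hbc hac (by grind) h1 h2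
  · exact sorted c a b hac.symm hbc.symm hab (by grind) h2 h1
  · exact sorted a b c hab hac hbc habc h1 h3
  · exact sorted a c b hac hab hbc.symm (by grind) h2 h3
  · exact sorted a b c hab hac hbc habc h1 h3

/-- Summing the reciprocal degrees over all incidences counts each vertex at most once. -/
theorem sum_sum_inv_degree_le_card {V : Type*} [Fintype V] [DecidableEq V]
    (E : Finset (Finset V)) :
    ∑ e ∈ E, ∑ v ∈ e, (degree E v : ℚ)⁻¹ ≤ Fintype.card V := by
  have hswap : ∑ e ∈ E, ∑ v ∈ e, (degree E v : ℚ)⁻¹ =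
      ∑ v : V, ∑ e ∈ E with v ∈ e, (degree E v : ℚ)⁻¹ :=
    Finset.sum_comm' (by simp)
  calc ∑ e ∈ E, ∑ v ∈ e, (degree E v : ℚ)⁻¹
      = ∑ v : V, (degree E v : ℚ) * (degree E v : ℚ)⁻¹ := by
        rw [hswap]
        simp only [Finset.sum_const, nsmul_eq_mul]
        rfl
    _ ≤ ∑ _v : V, (1 : ℚ) := Finset.sum_le_sum fun v _ => mul_inv_le_one
    _ = Fintype.card V := by simp

/-- If a crown-free linear 3-graph `H` on `n` vertices has no edge `e` with
`D(e) ≥ (4,4,3)` and no edge `e` with `D(e) ≥ (5,4,2)`, then `|E(H)| ≤ 3n/2`. -/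
theorem crown_free_no_critical_dominating_card_le {V : Type*} [Fintype V] [DecidableEq V]
    (E : Finset (Finset V)) (hlin : LinearTripleSystem E) (hcf : ¬ HasCrown E)
    (h443 : ¬ HasEdgeWithDegreesAtLeast E 4 4 3)
    (h542 : ¬ HasEdgeWithDegreesAtLeast E 5 4 2) :
    2 * E.card ≤ 3 * Fintype.card V := by
  have hlower : ∑ _e ∈ E, (2 / 3 : ℚ) ≤ ∑ e ∈ E, ∑ v ∈ e, (degree E v : ℚ)⁻¹ :=
    Finset.sum_le_sum fun e he => two_thirds_le_sum_inv_degree h443 h542 he (hlin.1 e he)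
  have hupper := sum_sum_inv_degree_le_card E
  rw [Finset.sum_const, nsmul_eq_mul] at hlower
  have : (2 * E.card : ℚ) ≤ 3 * Fintype.card V := by linarith
  exact_mod_cast this
end

section
/- If a crown-free linear 3-graph H on n vertices contains no critical configuration, i.e., no edge e with D(e) = (4,4,3) and no edge e with D(e) = (5,4,2), then the number of edges of H is at most 3n/2. -/
/-- `E` has an edge `{a,b,c}` whose degree vector, sorted in non-increasing order,
equals `(p,q,r)` (for a non-increasing pattern `p ≥ q ≥ r` this is equivalent to the
existence of a labelling as below). -/
def HasEdgeWithDegreesEq {V : Type*} [DecidableEq V] (E : Finset (Finset V))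
    (p q r : ℕ) : Prop :=
  ∃ a b c : V, a ≠ b ∧ a ≠ c ∧ b ≠ c ∧ ({a, b, c} : Finset V) ∈ E ∧
    degree E a = p ∧ degree E b = q ∧ degree E c = r

/-- Three edge-disjoint matchings such that no three pairs, one from each, are pairwise disjoint. -/
structure RainbowFree {V : Type*} (A B C : V → V → Prop) : Prop where
  symmA : ∀ {x y}, A x y → A y x
  symmB : ∀ {x y}, B x y → B y x
  symmC : ∀ {x y}, C x y → C y x
  irreflA : ∀ {x}, ¬ A x x
  irreflB : ∀ {x}, ¬ B x x
  irreflC : ∀ {x}, ¬ C x x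
  uniqA : ∀ {x y z}, A x y → A x z → y = z
  uniqB : ∀ {x y z}, B x y → B x z → y = z
  uniqC : ∀ {x y z}, C x y → C x z → y = z
  disjAB : ∀ {x y}, A x y → ¬ B x y
  disjAC : ∀ {x y}, A x y → ¬ C x y
  disjBC : ∀ {x y}, B x y → ¬ C x y
  meet : ∀ {x x' y y' z z'}, A x x' → B y y' → C z z' →
    x = y ∨ x = y' ∨ x' = y ∨ x' = y' ∨ x = z ∨ x = z' ∨ x' = z ∨ x' = z' ∨
      y = z ∨ y = z' ∨ y' = z ∨ y' = z'

/-- Any two points are avoided by two disjoint pairs of `A`. -/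
def TwoAvoiding {V : Type*} (A : V → V → Prop) : Prop :=
  ∀ u v, ∃ x x' y y', A x x' ∧ A y y' ∧ x ≠ y ∧ x ≠ y' ∧ x' ≠ y ∧ x' ≠ y' ∧
    x ≠ u ∧ x ≠ v ∧ x' ≠ u ∧ x' ≠ v ∧ y ≠ u ∧ y ≠ v ∧ y' ≠ u ∧ y' ≠ v

/-- Any two points are avoided by a pair of `C`. -/
def OneAvoiding {V : Type*} (C : V → V → Prop) : Prop :=
  ∀ u v, ∃ x x', C x x' ∧ x ≠ u ∧ x ≠ v ∧ x' ≠ u ∧ x' ≠ v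

theorem RainbowFree.exists_square {V : Type*} {A B C : V → V → Prop} (h : RainbowFree A B C)
    (hA : TwoAvoiding A) (hB : TwoAvoiding B) {x y : V} (hxy : C x y) :
    ∃ p q r s, A p q ∧ A r s ∧ B p r ∧ B q s ∧ p ≠ r ∧ p ≠ s ∧ q ≠ r ∧ q ≠ s ∧
     x ≠ p ∧ x ≠ q ∧ x ≠ r ∧ x ≠ s ∧ y ≠ p ∧ y ≠ q ∧ y ≠ r ∧ y ≠ s := by
  obtain ⟨p, q, r, s, hpq, hrs, h1, h2, h3, h4, h5, h6, h7, h8, h9, h10, h11, h12⟩ := hA x y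
  obtain ⟨p', q', r', s', hpq', hrs', h1', h2', h3', h4', h5', h6', h7', h8', h9', h10', h11',
    h12'⟩ := hB x y
  have m1 := h.meet hpq hpq' hxy
  have m2 := h.meet hpq hrs' hxy
  have m3 := h.meet hrs hpq' hxy
  have m4 := h.meet hrs hrs' hxy
  have := h.symmB hpq'
  have := h.symmB hrs'
  have : B p r ∧ B q s ∨ B p s ∧ B q r := by grind
  have hsr := h.symmA hrs
  rcases this with ⟨_, _⟩ | ⟨_, _⟩
  · exact ⟨p, q, r, s, by grind⟩
  · exact ⟨p, q, s, r, by grind⟩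

/-- Two disjoint pairs which both meet `{x, y}` and `{z, w}` match these two sets. -/
theorem cross_matching {V : Type*} {A : V → V → Prop} (symm : ∀ {x y}, A x y → A y x)
    {a a' b b' x y z w : V} (ha : A a a') (hb : A b b')
    (h1 : a ≠ b) (h2 : a ≠ b') (h3 : a' ≠ b) (h4 : a' ≠ b')
    (hzx : z ≠ x) (hzy : z ≠ y) (hwx : w ≠ x) (hwy : w ≠ y)
    (hax : a = x ∨ a = y ∨ a' = x ∨ a' = y) (hbx : b = x ∨ b = y ∨ b' = x ∨ b' = y)
    (haz : a = z ∨ a = w ∨ a' = z ∨ a' = w) (hbz : b = z ∨ b = w ∨ b' = z ∨ b' = w) :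
    A x z ∧ A y w ∨ A x w ∧ A y z := by
  have ha' := symm ha
  have hb' := symm hb
  clear symm
  rcases hax with rfl | rfl | rfl | rfl <;> rcases hbx with rfl | rfl | rfl | rfl <;> grind

/-- The complete graph on `p, q, r, s`, properly coloured by `A`, `B`, `C`. -/
def FullSquare {V : Type*} (A B C : V → V → Prop) (p q r s : V) : Prop :=
  A p q ∧ A r s ∧ B p r ∧ B q s ∧ C p s ∧ C q r

theorem RainbowFree.exists_fullSquare {V : Type*} {A B C : V → V → Prop} (h : RainbowFree A B C)
    (hA : TwoAvoiding A) (hB : TwoAvoiding B) (hC : OneAvoiding C) (o : V) :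
    ∃ p q r s, FullSquare A B C p q r s := by
  obtain ⟨x, y, hxy, -⟩ := hC o o
  obtain ⟨p, q, r, s, hpq, hrs, hpr, hqs, h1, h2, h3, h4, h5, h6, h7, h8, h9, h10, h11, h12⟩ :=
    h.exists_square hA hB hxy
  -- a pair disjoint from `x, y` is inside the square or yields another full square
  have key : ∀ z w, C z w → z ≠ x → z ≠ y → w ≠ x → w ≠ y →
      (∃ p q r s, FullSquare A B C p q r s) ∨ C p s ∧ (z = p ∨ z = s) ∨ C q r ∧ (z = q ∨ z = r) := by
    intro z w hzw hzx hzy hwx hwy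
    obtain ⟨a, a', b, b', ha, hb, k1, k2, k3, k4, k5, k6, k7, k8, k9, k10, k11, k12⟩ := hA p r
    obtain ⟨c, c', d, d', hc, hd, l1, l2, l3, l4, l5, l6, l7, l8, l9, l10, l11, l12⟩ := hB p q
    have outA : ∀ a a', A a a' → a ≠ p → a ≠ r → a' ≠ p → a' ≠ r →
        a ≠ q ∧ a ≠ s ∧ a' ≠ q ∧ a' ≠ s := by
      have := @h.uniqA
      have := @h.symmA
      grind
    have outB : ∀ a a', B a a' → a ≠ p → a ≠ q → a' ≠ p → a' ≠ q →
        a ≠ r ∧ a ≠ s ∧ a' ≠ r ∧ a' ≠ s := by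
      have := @h.uniqB
      have := @h.symmB
      grind
    obtain ⟨u1, u2, u3, u4⟩ := outA a a' ha k5 k6 k7 k8
    obtain ⟨v1, v2, v3, v4⟩ := outA b b' hb k9 k10 k11 k12
    obtain ⟨w1, w2, w3, w4⟩ := outB c c' hc l5 l6 l7 l8
    obtain ⟨t1, t2, t3, t4⟩ := outB d d' hd l9 l10 l11 l12
    have hitA : ∀ a a' i j, A a a' → a ≠ p → a ≠ r → a' ≠ p → a' ≠ r → C i j →
        (i ≠ p ∧ i ≠ r ∧ j ≠ p ∧ j ≠ r ∨ i ≠ q ∧ i ≠ s ∧ j ≠ q ∧ j ≠ s) →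
        a = i ∨ a = j ∨ a' = i ∨ a' = j := by
      intro a a' i j ha n1 n2 n3 n4 hij hor
      have := outA a a' ha n1 n2 n3 n4
      have := h.meet ha hpr hij
      have := h.meet ha hqs hij
      grind
    have hitB : ∀ a a' i j, B a a' → a ≠ p → a ≠ q → a' ≠ p → a' ≠ q → C i j →
        (i ≠ p ∧ i ≠ q ∧ j ≠ p ∧ j ≠ q ∨ i ≠ r ∧ i ≠ s ∧ j ≠ r ∧ j ≠ s) →
        a = i ∨ a = j ∨ a' = i ∨ a' = j := by
      intro a a' i j ha n1 n2 n3 n4 hij hor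
      have := outB a a' ha n1 n2 n3 n4
      have := h.meet hpq ha hij
      have := h.meet hrs ha hij
      grind
    have hax := hitA a a' x y ha k5 k6 k7 k8 hxy (by grind)
    have hbx := hitA b b' x y hb k9 k10 k11 k12 hxy (by grind)
    have hcx := hitB c c' x y hc l5 l6 l7 l8 hxy (by grind)
    have hdx := hitB d d' x y hd l9 l10 l11 l12 hxy (by grind)
    have haz := hitA a a' z w ha k5 k6 k7 k8 hzw
    have hbz := hitA b b' z w hb k9 k10 k11 k12 hzw
    have hcz := hitB c c' z w hc l5 l6 l7 l8 hzw
    have hdz := hitB d d' z w hd l9 l10 l11 l12 hzw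
    have d1 := h.disjAC hpq
    have d2 := h.disjAC hrs
    have d3 := h.disjBC hpr
    have d4 := h.disjBC hqs
    have d1' := h.disjAC (h.symmA hpq)
    have d2' := h.disjAC (h.symmA hrs)
    have d3' := h.disjBC (h.symmB hpr)
    have d4' := h.disjBC (h.symmB hqs)
    have hwz := h.symmC hzw
    by_cases hz : z = p ∨ z = q ∨ z = r ∨ z = s
    · right
      have : w = p ∨ w = q ∨ w = r ∨ w = s := by
        by_contra hw
        rcases hz with rfl | rfl | rfl | rfl <;> grind
      have := @h.irreflC
      rcases hz with rfl | rfl | rfl | rfl <;> rcases this with rfl | rfl | rfl | rfl <;> grind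
    by_cases hw : w = p ∨ w = q ∨ w = r ∨ w = s
    · exfalso
      rcases hw with rfl | rfl | rfl | rfl <;> grind
    left
    replace haz := haz (by grind)
    replace hbz := hbz (by grind)
    replace hcz := hcz (by grind)
    replace hdz := hdz (by grind)
    have hA1 := cross_matching (@h.symmA) ha hb k1 k2 k3 k4 hzx hzy hwx hwy hax hbx haz hbz
    have hB1 := cross_matching (@h.symmB) hc hd l1 l2 l3 l4 hzx hzy hwx hwy hcx hdx hcz hdz
    rcases hA1 with ⟨i1, i2⟩ | ⟨i1, i2⟩ <;> rcases hB1 with ⟨j1, j2⟩ | ⟨j1, j2⟩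
    · exact absurd j1 (h.disjAB i1)
    · exact ⟨x, z, w, y, i1, h.symmA i2, j1, h.symmB j2, hxy, hzw⟩
    · exact ⟨x, w, z, y, i1, h.symmA i2, j1, h.symmB j2, hxy, hwz⟩
    · exact absurd j1 (h.disjAB i1)
  obtain ⟨z, w, hzw, g1, g2, g3, g4⟩ := hC x y
  obtain ⟨z', w', hzw', g1', g2', g3', g4'⟩ := hC x z
  have := h.symmC hxy
  have := h.symmC hzw
  have := h.symmC hzw'
  rcases key z w hzw g1 g2 g3 g4 with h | k
  · exact h
  rcases key z' w' hzw' g1' (fun e => g3' (h.uniqC (e ▸ hzw') ‹C y x›)) g3'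
      (fun e => g1' (h.uniqC ‹C w' z'› (e ▸ ‹C y x›))) with h' | k'
  · exact h'
  refine ⟨p, q, r, s, hpq, hrs, hpr, hqs, ?_⟩
  have := @h.uniqC
  have := @h.symmC
  grind

theorem RainbowFree.false_of_pair_meets {V : Type*} {A B C : V → V → Prop}
    (h : RainbowFree A B C) (hA : TwoAvoiding A) (hB : TwoAvoiding B) (hC : OneAvoiding C)
    {p q r s u v : V} (hf : FullSquare A B C p q r s)
    (huv : u ≠ v) (nA : ¬ A u v) (nB : ¬ B u v) (nC : ¬ C u v)
    (mA : ∀ {x y}, A x y → x ≠ p → x ≠ q → x ≠ r → x ≠ s → y ≠ p → y ≠ q → y ≠ r → y ≠ s →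
      x = u ∨ x = v ∨ y = u ∨ y = v)
    (mB : ∀ {x y}, B x y → x ≠ p → x ≠ q → x ≠ r → x ≠ s → y ≠ p → y ≠ q → y ≠ r → y ≠ s →
      x = u ∨ x = v ∨ y = u ∨ y = v)
    (mC : ∀ {x y}, C x y → x ≠ p → x ≠ q → x ≠ r → x ≠ s → y ≠ p → y ≠ q → y ≠ r → y ≠ s →
      x = u ∨ x = v ∨ y = u ∨ y = v) : False := by
  obtain ⟨hpq, hrs, hpr, hqs, hps, hqr⟩ := hf
  have outA : ∀ {x y}, A x y → x ≠ p → x ≠ r → y ≠ p → y ≠ r →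
      x ≠ q ∧ x ≠ s ∧ y ≠ q ∧ y ≠ s := by
    have := @h.uniqA
    have := @h.symmA
    grind
  have outB : ∀ {x y}, B x y → x ≠ p → x ≠ q → y ≠ p → y ≠ q →
      x ≠ r ∧ x ≠ s ∧ y ≠ r ∧ y ≠ s := by
    have := @h.uniqB
    have := @h.symmB
    grind
  have outC : ∀ {x y}, C x y → x ≠ p → x ≠ q → y ≠ p → y ≠ q →
      x ≠ r ∧ x ≠ s ∧ y ≠ r ∧ y ≠ s := by
    have := @h.uniqC
    have := @h.symmC
    grind
  have pA : ∃ x y, A u x ∧ A v y ∧ (x ≠ p ∧ x ≠ q ∧ x ≠ r ∧ x ≠ s) ∧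
      (y ≠ p ∧ y ≠ q ∧ y ≠ r ∧ y ≠ s) ∧ (u ≠ p ∧ u ≠ q ∧ u ≠ r ∧ u ≠ s) ∧
      (v ≠ p ∧ v ≠ q ∧ v ≠ r ∧ v ≠ s) := by
    obtain ⟨x, x', y, y', hx, hy, k1, k2, k3, k4, k5, k6, k7, k8, k9, k10, k11, k12⟩ := hA p r
    obtain ⟨u1, u2, u3, u4⟩ := outA hx k5 k6 k7 k8
    obtain ⟨v1, v2, v3, v4⟩ := outA hy k9 k10 k11 k12
    have i1 := mA hx k5 u1 k6 u2 k7 u3 k8 u4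
    have i2 := mA hy k9 v1 k10 v2 k11 v3 k12 v4
    have hx' := h.symmA hx
    have hy' := h.symmA hy
    clear mA mB mC outA outB outC
    rcases i1 with rfl | rfl | rfl | rfl <;> rcases i2 with rfl | rfl | rfl | rfl <;>
      first
      | contradiction
      | exact ⟨_, _, by assumption, by assumption, by grind⟩
  have pB : ∃ x y, B u x ∧ B v y ∧ (x ≠ p ∧ x ≠ q ∧ x ≠ r ∧ x ≠ s) ∧
      (y ≠ p ∧ y ≠ q ∧ y ≠ r ∧ y ≠ s) := by
    obtain ⟨x, x', y, y', hx, hy, k1, k2, k3, k4, k5, k6, k7, k8, k9, k10, k11, k12⟩ := hB p q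
    obtain ⟨u1, u2, u3, u4⟩ := outB hx k5 k6 k7 k8
    obtain ⟨v1, v2, v3, v4⟩ := outB hy k9 k10 k11 k12
    have i1 := mB hx k5 k6 u1 u2 k7 k8 u3 u4
    have i2 := mB hy k9 k10 v1 v2 k11 k12 v3 v4
    have hx' := h.symmB hx
    have hy' := h.symmB hy
    clear mA mB mC outA outB outC
    rcases i1 with rfl | rfl | rfl | rfl <;> rcases i2 with rfl | rfl | rfl | rfl <;>
      first
      | contradiction
      | exact ⟨_, _, by assumption, by assumption, by grind⟩
  obtain ⟨x, y, hux, hvy, hx, hy, hu, hv⟩ := pA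
  obtain ⟨x', y', hux', hvy', hx', hy'⟩ := pB
  have pC : ∃ w, (C u w ∨ C v w) ∧ w ≠ p ∧ w ≠ q ∧ w ≠ r ∧ w ≠ s := by
    obtain ⟨z, w, hzw, k1, k2, k3, k4⟩ := hC p q
    obtain ⟨u1, u2, u3, u4⟩ := outC hzw k1 k2 k3 k4
    have hwz := h.symmC hzw
    rcases mC hzw k1 k2 u1 u2 k3 k4 u3 u4 with rfl | rfl | rfl | rfl
    · exact ⟨w, .inl hzw, by grind⟩
    · exact ⟨w, .inr hzw, by grind⟩
    · exact ⟨z, .inl hwz, by grind⟩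
    · exact ⟨z, .inr hwz, by grind⟩
  obtain ⟨w, hw, hw'⟩ := pC
  have nA' := fun t => nA (h.symmA t)
  have nB' := fun t => nB (h.symmB t)
  have nC' := fun t => nC (h.symmC t)
  clear mA mB mC outA outB outC
  rcases hw with hw | hw
  · have e1 := h.meet hvy hpr hw
    have e2 := h.meet hpq hvy' hw
    have := h.disjAB hvy
    grind
  · have e1 := h.meet hux hpr hw
    have e2 := h.meet hpq hux' hw
    have := h.disjAB hux
    grind

theorem FullSquare.swap₁ {V : Type*} {A B C : V → V → Prop} (h : RainbowFree A B C)
    {p q r s : V} (hf : FullSquare A B C p q r s) : FullSquare A B C q p s r :=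
  ⟨h.symmA hf.1, h.symmA hf.2.1, hf.2.2.2.1, hf.2.2.1, hf.2.2.2.2.2, hf.2.2.2.2.1⟩

theorem FullSquare.swap₂ {V : Type*} {A B C : V → V → Prop} (h : RainbowFree A B C)
    {p q r s : V} (hf : FullSquare A B C p q r s) : FullSquare A B C r s p q :=
  ⟨hf.2.1, hf.1, h.symmB hf.2.2.1, h.symmB hf.2.2.2.1, h.symmC hf.2.2.2.2.2,
    h.symmC hf.2.2.2.2.1⟩

section

variable {V : Type*} [DecidableEq V] {E : Finset (Finset V)}

theorem LinearTripleSystem.eq_of_mem (hE : LinearTripleSystem E) {f g : Finset V} (hf : f ∈ E)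
    (hg : g ∈ E) {x y : V} (hxy : x ≠ y) (hxf : x ∈ f) (hyf : y ∈ f) (hxg : x ∈ g)
    (hyg : y ∈ g) : f = g := by
  by_contra hne
  exact absurd (hE.2 f hf g hg hne) (not_le.2 (Finset.one_lt_card.2
    ⟨x, Finset.mem_inter.2 ⟨hxf, hxg⟩, y, Finset.mem_inter.2 ⟨hyf, hyg⟩, hxy⟩))

/-- An edge through `a` is `{a, x, y}` for some `x`, `y`. -/
theorem LinearTripleSystem.eq_triple (hE : LinearTripleSystem E) {f : Finset V} (hf : f ∈ E)
    {a : V} (ha : a ∈ f) : ∃ x y, a ≠ x ∧ a ≠ y ∧ x ≠ y ∧ f = {a, x, y} := by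
  obtain ⟨x, y, z, hxy, hxz, hyz, rfl⟩ := Finset.card_eq_three.1 (hE.1 f hf)
  simp only [Finset.mem_insert, Finset.mem_singleton] at ha
  rcases ha with rfl | rfl | rfl
  · exact ⟨y, z, hxy, hxz, hyz, rfl⟩
  · exact ⟨x, z, hxy.symm, hyz, hxz, by ext; simp; tauto⟩
  · exact ⟨x, y, hxz.symm, hyz.symm, hxy, by ext; simp; tauto⟩

theorem LinearTripleSystem.exists_edge_avoiding (hE : LinearTripleSystem E) {e T : Finset V}
    {a : V} (haT : a ∉ T) (hT : T.card + 1 < degree E a) :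
    ∃ f ∈ E, a ∈ f ∧ f ≠ e ∧ Disjoint f T := by
  by_contra! hcon
  have hmeet : ∀ f ∈ (E.filter (a ∈ ·)).erase e, ∃ t ∈ T, t ∈ f := by
    intro f hf
    simp only [Finset.mem_erase, Finset.mem_filter] at hf
    obtain ⟨t, htf, htT⟩ := Finset.not_disjoint_iff.1 (hcon f hf.2.1 hf.2.2 hf.1)
    exact ⟨t, htT, htf⟩
  have : Nonempty V := ⟨a⟩
  choose! t htT htf using hmeet
  have hcard : T.card < ((E.filter (a ∈ ·)).erase e).card :=
    lt_of_lt_of_le (by unfold degree at hT; omega) Finset.pred_card_le_card_erase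
  obtain ⟨f, hf, g, hg, hne, hfg⟩ := Finset.exists_ne_map_eq_of_card_lt_of_maps_to hcard htT
  have hf' := hf
  have hg' := hg
  simp only [Finset.mem_erase, Finset.mem_filter] at hf' hg'
  refine hne (hE.eq_of_mem hf'.2.1 hg'.2.1 (x := a) (y := t f) ?_ hf'.2.2 (htf f hf) hg'.2.2
    (hfg ▸ htf g hg))
  rintro h
  exact haT (h ▸ htT f hf)

/-- The pairs completing `a` to an edge, disjoint from `e` outside `a`. -/
def LinkOff (E : Finset (Finset V)) (e : Finset V) (a x y : V) : Prop :=
  x ≠ y ∧ x ∉ e ∧ y ∉ e ∧ ({a, x, y} : Finset V) ∈ E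

theorem LinearTripleSystem.exists_linkOff (hE : LinearTripleSystem E) {e T : Finset V} {a : V}
    (he : e ∈ E) (hae : a ∈ e) (haT : a ∉ T) (hT : T.card + 1 < degree E a) :
    ∃ x y, LinkOff E e a x y ∧ x ∉ T ∧ y ∉ T := by
  obtain ⟨f, hf, haf, hfe, hd⟩ := hE.exists_edge_avoiding (e := e) haT hT
  obtain ⟨x, y, hax, hay, hxy, rfl⟩ := hE.eq_triple hf haf
  rw [Finset.disjoint_left] at hd
  refine ⟨x, y, ⟨hxy, fun hx => hfe ?_, fun hy => hfe ?_, hf⟩, hd (by simp), hd (by simp)⟩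
  · exact hE.eq_of_mem hf he hax (by simp) (by simp) hae hx
  · exact hE.eq_of_mem hf he hay (by simp) (by simp) hae hy

theorem LinkOff.symm {e : Finset V} {a x y : V} (h : LinkOff E e a x y) : LinkOff E e a y x :=
  ⟨h.1.symm, h.2.2.1, h.2.1, by rw [Finset.pair_comm]; exact h.2.2.2⟩

theorem LinkOff.unique (hE : LinearTripleSystem E) {e : Finset V} {a x y z : V} (hae : a ∈ e)
    (h : LinkOff E e a x y) (h' : LinkOff E e a x z) : y = z := by
  have hax : a ≠ x := fun k => h.2.1 (k ▸ hae)
  have hay : a ≠ y := fun k => h.2.2.1 (k ▸ hae)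
  have := hE.eq_of_mem h.2.2.2 h'.2.2.2 hax (by simp) (by simp) (by simp) (by simp)
  have hy : y ∈ ({a, x, z} : Finset V) := this ▸ (by simp)
  have := h.1
  simp only [Finset.mem_insert, Finset.mem_singleton] at hy
  grind

theorem LinkOff.disjoint (hE : LinearTripleSystem E) {e : Finset V} {a b x y : V} (hab : a ≠ b)
    (hae : a ∈ e) (h : LinkOff E e a x y) : ¬ LinkOff E e b x y := by
  intro h'
  have := hE.eq_of_mem h.2.2.2 h'.2.2.2 h.1 (by simp) (by simp) (by simp) (by simp)
  have ha : a ∈ ({b, x, y} : Finset V) := this ▸ (by simp)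
  have := h.2.1
  have := h.2.2.1
  simp only [Finset.mem_insert, Finset.mem_singleton] at ha
  grind

theorem rainbowFree_linkOff (hE : LinearTripleSystem E) (hcf : ¬ HasCrown E) {a b c : V}
    (hab : a ≠ b) (hac : a ≠ c) (hbc : b ≠ c) (he : ({a, b, c} : Finset V) ∈ E) :
    RainbowFree (LinkOff E {a, b, c} a) (LinkOff E {a, b, c} b) (LinkOff E {a, b, c} c) where
  symmA := LinkOff.symm
  symmB := LinkOff.symm
  symmC := LinkOff.symm
  irreflA h := h.1 rfl
  irreflB h := h.1 rfl
  irreflC h := h.1 rfl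
  uniqA := LinkOff.unique hE (by simp)
  uniqB := LinkOff.unique hE (by simp)
  uniqC := LinkOff.unique hE (by simp)
  disjAB := LinkOff.disjoint hE hab (by simp)
  disjAC := LinkOff.disjoint hE hac (by simp)
  disjBC := LinkOff.disjoint hE hbc (by simp)
  meet := by
    rintro x x' y y' z z' ⟨-, hx, hx', hxE⟩ ⟨-, hy, hy', hyE⟩ ⟨-, hz, hz', hzE⟩
    by_contra! hcon
    simp only [Finset.mem_insert, Finset.mem_singleton, not_or] at hx hx' hy hy' hz hz'
    refine hcf ⟨_, he, _, hxE, _, hyE, _, hzE, ?_, ?_, ?_, ⟨a, by simp⟩, ⟨b, by simp⟩,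
      ⟨c, by simp⟩⟩ <;>
    · simp only [Finset.disjoint_left, Finset.mem_insert, Finset.mem_singleton]
      grind

theorem LinearTripleSystem.twoAvoiding_linkOff (hE : LinearTripleSystem E) {e : Finset V} {a : V}
    (he : e ∈ E) (hae : a ∈ e) (hd : 5 ≤ degree E a) : TwoAvoiding (LinkOff E e a) := by
  intro u v
  obtain ⟨x, x', hx, h1, h2⟩ := hE.exists_linkOff (T := ({u, v} : Finset V).erase a) he hae
    (by simp) (by have := Finset.card_erase_le (s := {u, v}) (a := a)
                  have := Finset.card_le_two (a := u) (b := v); omega)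
  obtain ⟨y, y', hy, h3, h4⟩ := hE.exists_linkOff (T := ({u, v, x} : Finset V).erase a) he hae
    (by simp) (by have := Finset.card_erase_le (s := {u, v, x}) (a := a)
                  have := Finset.card_le_three (a := u) (b := v) (c := x); omega)
  have hxa : x ≠ a := fun k => hx.2.1 (k ▸ hae)
  have hxa' : x' ≠ a := fun k => hx.2.2.1 (k ▸ hae)
  have hya : y ≠ a := fun k => hy.2.1 (k ▸ hae)
  have hya' : y' ≠ a := fun k => hy.2.2.1 (k ▸ hae)
  simp only [Finset.mem_erase, Finset.mem_insert, Finset.mem_singleton, not_and, not_or]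
    at h1 h2 h3 h4
  refine ⟨x, x', y, y', hx, hy, Ne.symm (h3 hya).2.2, Ne.symm (h4 hya').2.2, ?_, ?_, (h1 hxa).1,
    (h1 hxa).2, (h2 hxa').1, (h2 hxa').2, (h3 hya).1, (h3 hya).2.1, (h4 hya').1, (h4 hya').2.1⟩
  · rintro rfl
    exact (h4 hya').2.2 (hy.unique hE hae hx.symm)
  · rintro rfl
    exact (h3 hya).2.2 (hy.symm.unique hE hae hx.symm)

theorem LinearTripleSystem.oneAvoiding_linkOff (hE : LinearTripleSystem E) {e : Finset V} {a : V}
    (he : e ∈ E) (hae : a ∈ e) (hd : 4 ≤ degree E a) : OneAvoiding (LinkOff E e a) := by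
  intro u v
  obtain ⟨x, x', hx, h1, h2⟩ := hE.exists_linkOff (T := ({u, v} : Finset V).erase a) he hae
    (by simp) (by have := Finset.card_erase_le (s := {u, v}) (a := a)
                  have := Finset.card_le_two (a := u) (b := v); omega)
  have hxa : x ≠ a := fun k => hx.2.1 (k ▸ hae)
  have hxa' : x' ≠ a := fun k => hx.2.2.1 (k ▸ hae)
  simp only [Finset.mem_erase, Finset.mem_insert, Finset.mem_singleton, not_and, not_or] at h1 h2
  exact ⟨x, x', hx, (h1 hxa).1, (h1 hxa).2, (h2 hxa').1, (h2 hxa').2⟩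

theorem hasCrown_of_degrees (hE : LinearTripleSystem E) {a b c : V} (hab : a ≠ b) (hac : a ≠ c)
    (hbc : b ≠ c) (he : ({a, b, c} : Finset V) ∈ E) (ha : 6 ≤ degree E a) (hb : 4 ≤ degree E b)
    (hc : 2 ≤ degree E c) : HasCrown E := by
  by_contra hcf
  obtain ⟨z, z', hz, -⟩ := hE.exists_linkOff (T := ∅) he (a := c) (by simp) (by simp)
    (by simp; omega)
  obtain ⟨y, y', hy, h1, h2, h3, h4⟩ := hE.oneAvoiding_linkOff he (a := b) (by simp) hb z z'
  obtain ⟨x, x', hx, h5, h6⟩ := hE.exists_linkOff (T := {y, y', z, z'}) he (a := a) (by simp)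
    (by
      have h1 := hy.2.1
      have h2 := hy.2.2.1
      have h3 := hz.2.1
      have h4 := hz.2.2.1
      simp only [Finset.mem_insert, Finset.mem_singleton] at h1 h2 h3 h4 ⊢
      grind)
    (by have := Finset.card_le_four (a := y) (b := y') (c := z) (d := z'); omega)
  have := (rainbowFree_linkOff hE hcf hab hac hbc he).meet hx hy hz
  simp only [Finset.mem_insert, Finset.mem_singleton] at h5 h6
  grind

/-- If an edge `f` through `p` avoids a base edge `{a, p, q}` and an edge `{b, q, s}` elsewhere,
then it meets every further edge through `a` that avoids `{b, q, s}`. -/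
theorem LinkOff.meets (hcf : ¬ HasCrown E) {e : Finset V} {a b p q s u v x y : V} (hae : a ∈ e)
    (hbe : b ∈ e) (hab : a ≠ b) (hpq : LinkOff E e a p q) (hqs : LinkOff E e b q s)
    (hf : ({p, u, v} : Finset V) ∈ E) (hps : p ≠ s) (hu : u ∉ e) (hv : v ∉ e)
    (huq : u ≠ q) (hvq : v ≠ q) (hus : u ≠ s) (hvs : v ≠ s) (hxy : LinkOff E e a x y)
    (hxp : x ≠ p) (hxq : x ≠ q) (hxs : x ≠ s) (hyp : y ≠ p) (hyq : y ≠ q) (hys : y ≠ s) :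
    x = u ∨ x = v ∨ y = u ∨ y = v := by
  by_contra! hcon
  obtain ⟨g1, g2, g3, g4⟩ := hpq
  obtain ⟨k1, k2, k3, k4⟩ := hqs
  obtain ⟨l1, l2, l3, l4⟩ := hxy
  have n1 : ∀ z, z ∉ e → z ≠ a := fun z hz k => hz (k ▸ hae)
  have n2 : ∀ z, z ∉ e → z ≠ b := fun z hz k => hz (k ▸ hbe)
  refine hcf ⟨_, g4, _, hf, _, k4, _, l4, ?_, ?_, ?_, ⟨p, by simp⟩, ⟨q, by simp⟩,
      ⟨a, by simp⟩⟩ <;>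
  · simp only [Finset.disjoint_left, Finset.mem_insert, Finset.mem_singleton]
    grind

theorem FullSquare.edge_eq (hE : LinearTripleSystem E) (hcf : ¬ HasCrown E) {a b c : V}
    (hab : a ≠ b) (hac : a ≠ c) (hbc : b ≠ c) (he : ({a, b, c} : Finset V) ∈ E)
    (ha : 5 ≤ degree E a) (hb : 5 ≤ degree E b) (hc : 4 ≤ degree E c) {p q r s : V}
    (h : FullSquare (LinkOff E {a, b, c} a) (LinkOff E {a, b, c} b) (LinkOff E {a, b, c} c)
      p q r s) {f : Finset V} (hf : f ∈ E) (hpf : p ∈ f) :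
    f = {a, p, q} ∨ f = {b, p, r} ∨ f = {c, p, s} := by
  have hR := rainbowFree_linkOff hE hcf hab hac hbc he
  have hA := hE.twoAvoiding_linkOff he (a := a) (by simp) ha
  have hB := hE.twoAvoiding_linkOff he (a := b) (by simp) hb
  have hC := hE.oneAvoiding_linkOff he (a := c) (by simp) hc
  have hfull := h
  obtain ⟨hpq, hrs, hpr, hqs, hps, hqr⟩ := h
  by_contra! hcon
  obtain ⟨hfA, hfB, hfC⟩ := hcon
  have hpe := hpq.2.1
  have hpe' := hpe
  simp only [Finset.mem_insert, Finset.mem_singleton, not_or] at hpe'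
  obtain ⟨hpa, hpb, hpc⟩ := hpe'
  have avoid : ∀ t, t ≠ p → t ∈ f → ∀ g ∈ E, p ∈ g → t ∈ g → f = g := fun t htp ht g hg hpg htg =>
    hE.eq_of_mem hf hg htp.symm hpf ht hpg htg
  have haf : a ∉ f := fun k => hfA (avoid a (Ne.symm hpa) k _ hpq.2.2.2 (by simp) (by simp))
  have hbf : b ∉ f := fun k => hfB (avoid b (Ne.symm hpb) k _ hpr.2.2.2 (by simp) (by simp))
  have hcf' : c ∉ f := fun k => hfC (avoid c (Ne.symm hpc) k _ hps.2.2.2 (by simp) (by simp))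
  have hqf : q ∉ f := fun k => hfA (avoid q hpq.1.symm k _ hpq.2.2.2 (by simp) (by simp))
  have hrf : r ∉ f := fun k => hfB (avoid r hpr.1.symm k _ hpr.2.2.2 (by simp) (by simp))
  have hsf : s ∉ f := fun k => hfC (avoid s hps.1.symm k _ hps.2.2.2 (by simp) (by simp))
  obtain ⟨u, v, hpu, hpv, huv, rfl⟩ := hE.eq_triple hf hpf
  have hue : u ∉ ({a, b, c} : Finset V) := by
    simp only [Finset.mem_insert, Finset.mem_singleton] at haf hbf hcf' ⊢
    grind
  have hve : v ∉ ({a, b, c} : Finset V) := by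
    simp only [Finset.mem_insert, Finset.mem_singleton] at haf hbf hcf' ⊢
    grind
  have nL : ∀ {t}, t ∉ ({p, u, v} : Finset V) → ¬ LinkOff E {a, b, c} t u v := fun {t} ht k =>
    ht ((hE.eq_of_mem hf k.2.2.2 huv (by simp) (by simp) (by simp) (by simp)) ▸ (by simp))
  simp only [Finset.mem_insert, Finset.mem_singleton, not_or] at hqf hrf hsf
  refine hR.false_of_pair_meets hA hB hC hfull huv (nL haf) (nL hbf) (nL hcf') ?_ ?_ ?_
  · intro x y hxy h1 h2 h3 h4 h5 h6 h7 h8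
    exact LinkOff.meets hcf (by simp) (by simp) hab hpq hqs hf hps.1 hue hve (Ne.symm hqf.2.1)
      (Ne.symm hqf.2.2) (Ne.symm hsf.2.1) (Ne.symm hsf.2.2) hxy h1 h2 h4 h5 h6 h8
  · intro x y hxy h1 h2 h3 h4 h5 h6 h7 h8
    exact LinkOff.meets hcf (by simp) (by simp) hab.symm hpr hrs hf hps.1 hue hve
      (Ne.symm hrf.2.1) (Ne.symm hrf.2.2) (Ne.symm hsf.2.1) (Ne.symm hsf.2.2) hxy h1 h3 h4 h5 h7 h8
  · intro x y hxy h1 h2 h3 h4 h5 h6 h7 h8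
    exact LinkOff.meets hcf (by simp) (by simp) hac.symm hps hrs.symm hf hpr.1 hue hve
      (Ne.symm hsf.2.1) (Ne.symm hsf.2.2) (Ne.symm hrf.2.1) (Ne.symm hrf.2.2) hxy h1 h4 h3 h5 h8 h7

/-- Around an edge of degrees at least `(5, 5, 4)` there are four vertices of degree three. -/
theorem exists_four_vertices_six_edges (hE : LinearTripleSystem E) (hcf : ¬ HasCrown E) {a b c : V}
    (hab : a ≠ b) (hac : a ≠ c) (hbc : b ≠ c) (he : ({a, b, c} : Finset V) ∈ E)
    (ha : 5 ≤ degree E a) (hb : 5 ≤ degree E b) (hc : 4 ≤ degree E c) :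
    ∃ Q : Finset V, Q.card = 4 ∧ (∀ v ∈ Q, ∃ f ∈ E, v ∈ f) ∧
      (E.filter (fun f => ¬ Disjoint f Q)).card ≤ 6 := by
  have hR := rainbowFree_linkOff hE hcf hab hac hbc he
  obtain ⟨p, q, r, s, h⟩ := hR.exists_fullSquare (hE.twoAvoiding_linkOff he (by simp) ha)
    (hE.twoAvoiding_linkOff he (by simp) hb) (hE.oneAvoiding_linkOff he (by simp) hc) a
  have key := fun {p q r s : V} => FullSquare.edge_eq hE hcf hab hac hbc he ha hb hc
    (p := p) (q := q) (r := r) (s := s)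
  have hp := fun {f} => key h (f := f)
  have hq := fun {f} => key (h.swap₁ hR) (f := f)
  have hr := fun {f} => key (h.swap₂ hR) (f := f)
  have hs := fun {f} => key ((h.swap₂ hR).swap₁ hR) (f := f)
  obtain ⟨hpq, hrs, hpr, hqs, hps, hqr⟩ := h
  refine ⟨{p, q, r, s}, ?_, ?_, ?_⟩
  · exact Finset.card_eq_four.2
      ⟨p, q, r, s, hpq.1, hpr.1, hps.1, hqr.1, hqs.1, hrs.1, rfl⟩
  · simp only [Finset.mem_insert, Finset.mem_singleton]
    rintro v (rfl | rfl | rfl | rfl)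
    · exact ⟨_, hpq.2.2.2, by simp⟩
    · exact ⟨_, hpq.2.2.2, by simp⟩
    · exact ⟨_, hrs.2.2.2, by simp⟩
    · exact ⟨_, hrs.2.2.2, by simp⟩
  · refine le_trans (Finset.card_le_card (t := {{a, p, q}, {a, r, s}, {b, p, r}, {b, q, s},
      {c, p, s}, {c, q, r}}) fun f hf => ?_) Finset.card_le_six
    obtain ⟨hfE, hfQ⟩ := Finset.mem_filter.1 hf
    obtain ⟨v, hvf, hvQ⟩ := Finset.not_disjoint_iff.1 hfQ
    simp only [Finset.mem_insert, Finset.mem_singleton] at hvQ ⊢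
    rcases hvQ with rfl | rfl | rfl | rfl
    · rcases hp hfE hvf with h | h | h <;> simp [h]
    · rcases hq hfE hvf with h | h | h <;> simp [h, Finset.pair_comm]
    · rcases hr hfE hvf with h | h | h <;> simp [h, Finset.pair_comm]
    · rcases hs hfE hvf with h | h | h <;> simp [h, Finset.pair_comm]

theorem degree_pos_of_mem {e : Finset V} (he : e ∈ E) {v : V} (hv : v ∈ e) : 1 ≤ degree E v :=
  Finset.card_pos.2 ⟨e, Finset.mem_filter.2 ⟨he, hv⟩⟩

theorem two_thirds_le_inv_degrees_of_sorted (hE : LinearTripleSystem E) (hcf : ¬ HasCrown E)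
    {a b c : V} (hab : a ≠ b) (hac : a ≠ c) (hbc : b ≠ c) (he : ({a, b, c} : Finset V) ∈ E)
    (h554 : 5 ≤ degree E a → 5 ≤ degree E b → degree E c < 4)
    (hba : degree E b ≤ degree E a) (hcb : degree E c ≤ degree E b) :
    (2 / 3 : ℚ) ≤ (degree E a : ℚ)⁻¹ + (degree E b : ℚ)⁻¹ + (degree E c : ℚ)⁻¹ := by
  have h642 := fun h1 h2 h3 => hcf (hasCrown_of_degrees hE hab hac hbc he h1 h2 h3)
  have hc0 : 1 ≤ degree E c := degree_pos_of_mem he (by simp)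
  generalize degree E a = i at *
  generalize degree E b = j at *
  generalize degree E c = k at *
  have inv_le : ∀ {m n : ℕ}, 1 ≤ m → m ≤ n → (n : ℚ)⁻¹ ≤ (m : ℚ)⁻¹ := fun {m n} hm hmn =>
    inv_anti₀ (by exact_mod_cast hm) (by exact_mod_cast hmn)
  have hi0 : (0 : ℚ) ≤ (i : ℚ)⁻¹ := by positivity
  have hj0 : (0 : ℚ) ≤ (j : ℚ)⁻¹ := by positivity
  rcases Nat.lt_or_ge k 2 with hk | hk
  · have := inv_le hc0 (show k ≤ 1 by omega)
    norm_num at this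
    linarith
  rcases Nat.lt_or_ge j 4 with hj | hj
  · have h1 := inv_le (show 1 ≤ j by omega) (show j ≤ 3 by omega)
    have h2 := inv_le hc0 (show k ≤ 3 by omega)
    norm_num at h1 h2
    linarith
  have hi : i ≤ 5 := by
    by_contra hi
    exact h642 (by omega) hj hk
  have h1 := inv_le (show 1 ≤ i by omega) hi
  rcases Nat.lt_or_ge j 5 with hj' | hj'
  · have h2 := inv_le (show 1 ≤ j by omega) (show j ≤ 4 by omega)
    have h3 := inv_le hc0 (show k ≤ 4 by omega)
    norm_num at h1 h2 h3
    linarith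
  · have h2 := inv_le (show 1 ≤ j by omega) (show j ≤ 5 by omega)
    have h3 := inv_le hc0 (show k ≤ 3 by have := h554 (by omega) hj'; omega)
    norm_num at h1 h2 h3
    linarith

theorem two_thirds_le_sum_inv_degree_s2 (hE : LinearTripleSystem E) (hcf : ¬ HasCrown E)
    (h554 : ∀ a b c : V, a ≠ b → a ≠ c → b ≠ c → ({a, b, c} : Finset V) ∈ E →
      5 ≤ degree E a → 5 ≤ degree E b → degree E c < 4) {e : Finset V} (he : e ∈ E) :
    (2 / 3 : ℚ) ≤ ∑ v ∈ e, (degree E v : ℚ)⁻¹ := by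
  have key : ∀ a b c : V, a ≠ b → a ≠ c → b ≠ c → e = {a, b, c} →
      degree E b ≤ degree E a → degree E c ≤ degree E b →
      (2 / 3 : ℚ) ≤ ∑ v ∈ e, (degree E v : ℚ)⁻¹ := by
    rintro a b c hab hac hbc rfl hba hcb
    rw [Finset.sum_insert (by simp [hab, hac]), Finset.sum_insert (by simp [hbc]),
      Finset.sum_singleton, ← add_assoc]
    exact two_thirds_le_inv_degrees_of_sorted hE hcf hab hac hbc he
      (h554 a b c hab hac hbc he) hba hcb
  obtain ⟨x, y, z, hxy, hxz, hyz, h⟩ := Finset.card_eq_three.1 (hE.1 e he)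
  rcases le_total (degree E x) (degree E y) with h1 | h1 <;>
  rcases le_total (degree E x) (degree E z) with h2 | h2 <;>
  rcases le_total (degree E y) (degree E z) with h3 | h3
  · exact key z y x hyz.symm hxz.symm hxy.symm (by rw [h]; ext; simp; tauto) h3 h1
  · exact key y z x hyz hxy.symm hxz.symm (by rw [h]; ext; simp; tauto) h3 h2
  · exact key y x z hxy.symm hyz hxz (by rw [h]; ext; simp; tauto) h1 h2
  · exact key y x z hxy.symm hyz hxz (by rw [h]; ext; simp; tauto) h1 h2
  · exact key z x y hxz.symm hyz.symm hxy (by rw [h]; ext; simp; tauto) h2 h1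
  · exact key x y z hxy hxz hyz h h1 h3
  · exact key x z y hxz hxy hyz.symm (by rw [h]; ext; simp; tauto) h2 h3
  · exact key x y z hxy hxz hyz h h1 h3

theorem sum_sum_inv_degree_le {S : Finset V} (hS : ∀ e ∈ E, e ⊆ S) :
    ∑ e ∈ E, ∑ v ∈ e, (degree E v : ℚ)⁻¹ ≤ S.card := by
  have hcomm : ∑ e ∈ E, ∑ v ∈ e, (degree E v : ℚ)⁻¹ =
      ∑ v ∈ S, ∑ e ∈ E with v ∈ e, (degree E v : ℚ)⁻¹ := by
    refine Finset.sum_comm' fun e v => ?_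
    simp only [Finset.mem_filter]
    exact ⟨fun h => ⟨⟨h.1, h.2⟩, hS e h.1 h.2⟩, fun h => h.1⟩
  rw [hcomm, Finset.card_eq_sum_ones, Nat.cast_sum]
  refine Finset.sum_le_sum fun v _ => ?_
  rw [Finset.sum_const, nsmul_eq_mul]
  exact (mul_inv_le_one (a := (degree E v : ℚ))).trans_eq Nat.cast_one.symm

theorem crown_free_card_le {S : Finset V} (hE : LinearTripleSystem E) (hcf : ¬ HasCrown E)
    (hS : ∀ e ∈ E, e ⊆ S) : 2 * E.card ≤ 3 * S.card := by
  induction S using Finset.strongInduction generalizing E with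
  | H S ih =>
  by_cases h554 : ∀ a b c : V, a ≠ b → a ≠ c → b ≠ c → ({a, b, c} : Finset V) ∈ E →
      5 ≤ degree E a → 5 ≤ degree E b → degree E c < 4
  · have h1 : E.card • (2 / 3 : ℚ) ≤ ∑ e ∈ E, ∑ v ∈ e, (degree E v : ℚ)⁻¹ :=
      Finset.card_nsmul_le_sum _ _ _ fun e he => two_thirds_le_sum_inv_degree_s2 hE hcf h554 he
    have h2 := h1.trans (sum_sum_inv_degree_le hS)
    rw [nsmul_eq_mul] at h2
    have h3 : (2 * E.card : ℚ) ≤ 3 * S.card := by linarith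
    exact_mod_cast h3
  · push Not at h554
    obtain ⟨a, b, c, hab, hac, hbc, he, ha, hb, hc⟩ := h554
    obtain ⟨Q, hQ, hQE, hQ6⟩ := exists_four_vertices_six_edges hE hcf hab hac hbc he ha hb hc
    have hQS : Q ⊆ S := fun v hv => by
      obtain ⟨f, hf, hvf⟩ := hQE v hv
      exact hS f hf hvf
    have hsub : E.filter (Disjoint · Q) ⊆ E := Finset.filter_subset _ _
    have hlt : S \ Q ⊂ S := Finset.sdiff_ssubset hQS (Finset.card_pos.1 (by omega))
    have := ih (S \ Q) hlt (E := E.filter (Disjoint · Q))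
      ⟨fun e he => hE.1 e (hsub he), fun e he f hf => hE.2 e (hsub he) f (hsub hf)⟩
      (fun ⟨g, hg, j1, h1, j2, h2, j3, h3, h⟩ =>
        hcf ⟨g, hsub hg, j1, hsub h1, j2, hsub h2, j3, hsub h3, h⟩)
      (fun e he => Finset.subset_sdiff.2 ⟨hS e (hsub he), (Finset.mem_filter.1 he).2⟩)
    have hcard := Finset.card_sdiff_add_card_eq_card hQS
    have hsplit := Finset.card_filter_add_card_filter_not (s := E) (Disjoint · Q)
    omega

end

/-- If a crown-free linear 3-graph `H` on `n` vertices contains no critical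
configuration, i.e. no edge `e` with `D(e) = (4,4,3)` and no edge `e` with
`D(e) = (5,4,2)`, then `|E(H)| ≤ 3n/2`. -/
theorem crown_free_no_critical_config_card_le {V : Type*} [Fintype V] [DecidableEq V]
    (E : Finset (Finset V)) (hlin : LinearTripleSystem E) (hcf : ¬ HasCrown E)
    (h443 : ¬ HasEdgeWithDegreesEq E 4 4 3)
    (h542 : ¬ HasEdgeWithDegreesEq E 5 4 2) :
    2 * E.card ≤ 3 * Fintype.card V := by
  exact crown_free_card_le hlin hcf fun e _ => Finset.subset_univ e
end

section
/- (Good quintuple lemma.) Let H be a crown-free linear 3-graph, let e = {a,b,c} be an edge of H, and let x1, x2, x3, x4, x5 be five distinct vertices, none of which lies in {a,b,c}. Suppose there exist y, z ∈ {a,b,c} such that {x1,x2,y}, {x2,x3,z}, and {x4,x5,y} are all edges of H. Then there is no edge f of H such that f ∩ {a,b,c} = ∅ and f ∩ {x1,x2,x3,x4,x5} = {x1}. -/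
/-- Good quintuple lemma: in a crown-free linear 3-graph with an edge `{a,b,c}`,
if `x1,…,x5` are five distinct vertices avoiding `{a,b,c}` such that
`{x1,x2,y}`, `{x2,x3,z}`, `{x4,x5,y}` are edges for some `y, z ∈ {a,b,c}`,
then no edge `f` satisfies `f ∩ {a,b,c} = ∅` and `f ∩ {x1,x2,x3,x4,x5} = {x1}`. -/
theorem good_quintuple_lemma {V : Type*} [DecidableEq V] (E : Finset (Finset V))
    (hlin : LinearTripleSystem E) (hcf : ¬ HasCrown E)
    (a b c : V) (he : ({a, b, c} : Finset V) ∈ E)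
    (x1 x2 x3 x4 x5 : V)
    (hnodup : ([x1, x2, x3, x4, x5] : List V).Nodup)
    (havoid : ∀ x ∈ ([x1, x2, x3, x4, x5] : List V), x ∉ ({a, b, c} : Finset V))
    (y z : V) (hy : y ∈ ({a, b, c} : Finset V)) (hz : z ∈ ({a, b, c} : Finset V))
    (h1 : ({x1, x2, y} : Finset V) ∈ E)
    (h2 : ({x2, x3, z} : Finset V) ∈ E)
    (h3 : ({x4, x5, y} : Finset V) ∈ E) :
    ¬ ∃ f ∈ E, f ∩ ({a, b, c} : Finset V) = ∅ ∧
        f ∩ ({x1, x2, x3, x4, x5} : Finset V) = {x1} := by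
  simp only [List.nodup_cons, List.mem_cons, List.not_mem_nil, or_false, not_or] at hnodup
  simp only [List.mem_cons, List.not_mem_nil, or_false] at havoid
  have avoid : ∀ x, x = x1 ∨ x = x2 ∨ x = x3 ∨ x = x4 ∨ x = x5 → x ≠ y ∧ x ≠ z :=
    fun x hx => ⟨fun h => havoid x hx (h ▸ hy), fun h => havoid x hx (h ▸ hz)⟩
  have hyz : y ≠ z := by
    rintro rfl
    have hne : ({x1, x2, y} : Finset V) ≠ {x2, x3, y} := fun h => by
      have hx1 : x1 ∈ ({x2, x3, y} : Finset V) := h ▸ by simp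
      simp only [Finset.mem_insert, Finset.mem_singleton] at hx1
      grind
    have hcard := Finset.card_le_one.mp (hlin.2 _ h1 _ h2 hne) x2 (by simp) y (by simp)
    exact (avoid x2 (by simp)).1 hcard
  rintro ⟨f, hf, hfe, hfx⟩
  have hf1 : x1 ∈ f := (Finset.mem_inter.mp (hfx ▸ Finset.mem_singleton_self x1)).1
  have hfabc : ∀ v ∈ f, v ∉ ({a, b, c} : Finset V) := fun v hv hv' =>
    Finset.notMem_empty v (hfe ▸ Finset.mem_inter.mpr ⟨hv, hv'⟩)
  have hfxs : ∀ v ∈ f, v ∈ ({x1, x2, x3, x4, x5} : Finset V) → v = x1 := fun v hv hv' =>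
    Finset.mem_singleton.mp (hfx ▸ Finset.mem_inter.mpr ⟨hv, hv'⟩)
  have hfy : y ∉ f := fun h => hfabc y h hy
  have hfz : z ∉ f := fun h => hfabc z h hz
  simp only [Finset.mem_insert, Finset.mem_singleton] at hfxs
  refine hcf ⟨_, h1, f, hf, _, h2, _, h3, ?_, ?_, ?_, ⟨x1, by simp [hf1]⟩,
    ⟨x2, by simp⟩, ⟨y, by simp⟩⟩ <;>
  · rw [Finset.disjoint_left]
    simp only [Finset.mem_insert, Finset.mem_singleton]
    grind
end

section
/- Let H be a crown-free linear 3-graph with no edge e satisfying D(e) ≥ (4,4,3) and no edge e satisfying D(e) ≥ (5,4,2). Let Z be the set of vertices of degree at most 3, let Z1 be the set of vertices of degree exactly 3, let Z3 be the set of special vertices, let Z2 be the set of vertices of degree exactly 2 that are not special, and let Y be the set of vertices of degree at least 4. Let E2 be the set of edges of H that intersect Z in exactly one vertex, and for a vertex v let d_{E2}(v) be the number of edges of E2 containing v. Then: (1) d_{E2}(v) = 0 for every v ∈ Z1; (2) d_{E2}(v) ≤ 1 for every v ∈ Z2; and (3) |Z3| ≤ |Y|. -/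
/-- A special vertex: it has degree 2 and every other vertex of either of
the two edges containing it has degree exactly 4. -/
def SpecialVertex {V : Type*} [DecidableEq V] (E : Finset (Finset V)) (v : V) : Prop :=
  degree E v = 2 ∧ ∀ f ∈ E, v ∈ f → ∀ u ∈ f, u ≠ v → degree E u = 4

/-- The edges of `E` intersecting `Z = {v | d(v) ≤ 3}` in exactly one vertex. -/
def E2edges {V : Type*} [DecidableEq V] (E : Finset (Finset V)) : Finset (Finset V) :=
  E.filter (fun f => (f.filter (fun u => degree E u ≤ 3)).card = 1)

open Finset in
/-- The vertices other than `v` in an edge of `E₂` through a vertex `v` of degree at most 3 have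
degree at least 4. -/
theorem four_le_degree_of_mem_E2edges {V : Type*} [DecidableEq V] {E : Finset (Finset V)}
    {f : Finset V} (hf : f ∈ E2edges E) {v u : V} (hvf : v ∈ f) (hv : degree E v ≤ 3)
    (huf : u ∈ f) (huv : u ≠ v) : 4 ≤ degree E u := by
  by_contra! hu
  obtain ⟨w, hw⟩ := card_eq_one.1 (mem_filter.1 hf).2
  have h1 : v ∈ ({w} : Finset V) := hw ▸ mem_filter.2 ⟨hvf, hv⟩
  have h2 : u ∈ ({w} : Finset V) := hw ▸ mem_filter.2 ⟨huf, by omega⟩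
  exact huv ((mem_singleton.1 h2).trans (mem_singleton.1 h1).symm)

/-- A set of three elements containing `v` and `u ≠ v` is `{u, w, v}` for some third `w`. -/
theorem exists_eq_triple_of_card_eq_three {V : Type*} [DecidableEq V] {f : Finset V}
    (hf : f.card = 3) {u v : V} (hu : u ∈ f) (hv : v ∈ f) (huv : u ≠ v) :
    ∃ w, u ≠ w ∧ w ≠ v ∧ f = {u, w, v} := by
  obtain ⟨x, y, z, hxy, hxz, hyz, rfl⟩ := Finset.card_eq_three.1 hf
  simp only [Finset.mem_insert, Finset.mem_singleton] at hu hv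
  rcases hu with rfl | rfl | rfl <;> rcases hv with rfl | rfl | rfl
  · exact absurd rfl huv
  · exact ⟨z, hxz, hyz.symm, by grind⟩
  · exact ⟨y, hxy, hyz, rfl⟩
  · exact ⟨z, hyz, hxz.symm, by grind⟩
  · exact absurd rfl huv
  · exact ⟨x, hxy.symm, hxz, by grind⟩
  · exact ⟨y, hyz.symm, hxy.symm, by grind⟩
  · exact ⟨x, hxz.symm, hxy, by grind⟩
  · exact absurd rfl huv

open Finset in
/-- A vertex of degree 2 in a linear triple system has at least four neighbours. -/
theorem four_le_card_neighbours_of_degree_eq_two {V : Type*} [DecidableEq V]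
    {E : Finset (Finset V)} (hlin : LinearTripleSystem E) {v : V} (hv : degree E v = 2)
    {t : Finset V} (ht : ∀ f ∈ E, v ∈ f → ∀ u ∈ f, u ≠ v → u ∈ t) : 4 ≤ t.card := by
  obtain ⟨e, f, hef, h⟩ := card_eq_two.1 hv
  obtain ⟨he, hve⟩ := mem_filter.1 (h ▸ mem_insert_self e {f} : e ∈ E.filter (v ∈ ·))
  obtain ⟨hf, hvf⟩ := mem_filter.1
    (h ▸ mem_insert_of_mem (mem_singleton_self f) : f ∈ E.filter (v ∈ ·))
  have hdisj : Disjoint (e.erase v) (f.erase v) := by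
    rw [disjoint_left]
    intro u hue huf
    exact (mem_erase.1 hue).1 <| card_le_one.1 (hlin.2 e he f hf hef) u
      (mem_inter.2 ⟨mem_of_mem_erase hue, mem_of_mem_erase huf⟩) v (mem_inter.2 ⟨hve, hvf⟩)
  have hcard : (e.erase v ∪ f.erase v).card = 4 := by
    rw [card_union_of_disjoint hdisj, card_erase_of_mem hve, card_erase_of_mem hvf,
      hlin.1 e he, hlin.1 f hf]
  rw [← hcard]
  refine card_le_card (union_subset ?_ ?_) <;> intro u hu
  · exact ht e he hve u (mem_of_mem_erase hu) (mem_erase.1 hu).1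
  · exact ht f hf hvf u (mem_of_mem_erase hu) (mem_erase.1 hu).1

open Finset in
/-- Special vertices sharing an edge with `y` are at most as many as the edges through `y`. -/
theorem card_special_neighbours_le_degree {V : Type*} [DecidableEq V]
    {E : Finset (Finset V)} {y : V} {s : Finset V}
    (hs : ∀ v ∈ s, SpecialVertex E v ∧ ∃ f ∈ E, v ∈ f ∧ y ∈ f) : s.card ≤ degree E y := by
  classical
  have hsub : s ⊆ (E.filter (y ∈ ·)).biUnion fun f => f.filter (SpecialVertex E) := by
    intro v hv
    obtain ⟨hsp, f, hf, hvf, hyf⟩ := hs v hv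
    exact mem_biUnion.2 ⟨f, mem_filter.2 ⟨hf, hyf⟩, mem_filter.2 ⟨hvf, hsp⟩⟩
  refine (card_le_card hsub).trans
    ((card_biUnion_le_card_mul _ _ 1 fun f hf => ?_).trans_eq (mul_one _))
  refine card_le_one.2 fun a ha b hb => ?_
  by_contra hab
  obtain ⟨haf, ha⟩ := mem_filter.1 ha
  obtain ⟨hbf, hb⟩ := mem_filter.1 hb
  have h4 := ha.2 f (mem_filter.1 hf).1 haf b hbf (Ne.symm hab)
  have h2 := hb.1
  omega

open Finset in
/-- In a linear triple system there are at most as many special vertices as vertices of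
degree at least 4. -/
theorem ncard_special_le_ncard_four_le_degree {V : Type*} [Fintype V] [DecidableEq V]
    {E : Finset (Finset V)} (hlin : LinearTripleSystem E) :
    {v : V | SpecialVertex E v}.ncard ≤ {v : V | 4 ≤ degree E v}.ncard := by
  classical
  let r : V → V → Prop := fun v y => ∃ f ∈ E, v ∈ f ∧ y ∈ f
  have key : (univ.filter (SpecialVertex E)).card * 4 ≤
      (univ.filter fun y => degree E y = 4).card * 4 := by
    refine card_mul_le_card_mul r (fun v hv => ?_) (fun y hy => ?_)
    · have hv := (mem_filter.1 hv).2
      refine four_le_card_neighbours_of_degree_eq_two hlin hv.1 fun f hf hvf u huf huv => ?_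
      exact mem_filter.2 ⟨mem_filter.2 ⟨mem_univ _, hv.2 f hf hvf u huf huv⟩, f, hf, hvf, huf⟩
    · rw [← (mem_filter.1 hy).2]
      refine card_special_neighbours_le_degree fun v hv => ?_
      obtain ⟨hv, hr⟩ := mem_filter.1 hv
      exact ⟨(mem_filter.1 hv).2, hr⟩
  have hle : (univ.filter fun y => degree E y = 4).card ≤
      (univ.filter fun y => 4 ≤ degree E y).card :=
    card_le_card (monotone_filter_right _ fun y _ hy => hy.ge)
  rw [Set.ncard_eq_toFinset_card', Set.ncard_eq_toFinset_card', Set.toFinset_ofPred,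
    Set.toFinset_ofPred]
  omega

/-- Proposition: for a crown-free linear 3-graph with no edge `e` with
`D(e) ≥ (4,4,3)` or `D(e) ≥ (5,4,2)`:
(1) every vertex of degree 3 lies in no edge of `E₂`;
(2) every non-special vertex of degree 2 lies in at most one edge of `E₂`;
(3) the number of special vertices (`Z₃`) is at most the number of vertices of
degree at least 4 (`Y`). -/
theorem crown_free_E2_degrees_and_special_count {V : Type*} [Fintype V] [DecidableEq V]
    (E : Finset (Finset V)) (hlin : LinearTripleSystem E) (hcf : ¬ HasCrown E)
    (h443 : ¬ HasEdgeWithDegreesAtLeast E 4 4 3)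
    (h542 : ¬ HasEdgeWithDegreesAtLeast E 5 4 2) :
    (∀ v : V, degree E v = 3 → degree (E2edges E) v = 0) ∧
    (∀ v : V, degree E v = 2 → ¬ SpecialVertex E v → degree (E2edges E) v ≤ 1) ∧
    ({v : V | SpecialVertex E v}.ncard ≤ {v : V | 4 ≤ degree E v}.ncard) := by
  refine ⟨fun v hv => ?_, fun v hv hns => ?_, ncard_special_le_ncard_four_le_degree hlin⟩
  · refine Finset.card_eq_zero.2 (Finset.filter_eq_empty_iff.2 fun f hf hvf => ?_)
    have hfE : f ∈ E := (Finset.mem_filter.1 hf).1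
    obtain ⟨u, huf, huv⟩ := Finset.exists_mem_ne (by rw [hlin.1 f hfE]; norm_num) v
    obtain ⟨w, huw, hwv, rfl⟩ := exists_eq_triple_of_card_eq_three (hlin.1 f hfE) huf hvf huv
    exact h443 ⟨u, w, v, huw, huv, hwv, hfE,
      four_le_degree_of_mem_E2edges hf hvf hv.le huf huv,
      four_le_degree_of_mem_E2edges hf hvf hv.le (by simp) hwv, hv.ge⟩
  · by_contra! hlt
    have hsub : (E2edges E).filter (v ∈ ·) ⊆ E.filter (v ∈ ·) :=
      Finset.filter_subset_filter _ (Finset.filter_subset _ _)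
    have heq := Finset.eq_of_subset_of_card_le hsub (hv.trans_le hlt)
    refine hns ⟨hv, fun f hf hvf u huf huv => ?_⟩
    have hf2 : f ∈ E2edges E :=
      (Finset.mem_filter.1 (heq.symm ▸ Finset.mem_filter.2 ⟨hf, hvf⟩)).1
    have hu := four_le_degree_of_mem_E2edges hf2 hvf (by omega) huf huv
    refine le_antisymm (Nat.le_of_lt_succ (not_le.1 fun h5 => ?_)) hu
    obtain ⟨w, huw, hwv, rfl⟩ := exists_eq_triple_of_card_eq_three (hlin.1 f hf) huf hvf huv
    exact h542 ⟨u, w, v, huw, huv, hwv, hf, h5,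
      four_le_degree_of_mem_E2edges hf2 hvf (by omega) (by simp) hwv, hv.ge⟩
end

section
/- For every k ≥ 1, the following 3-graph H on the n = 4k + 3 vertices {a, b, c} ∪ {x_i, y_i, z_i, w_i : 1 ≤ i ≤ k} (all distinct) is a crown-free linear 3-graph with exactly 6k = 6(n−3)/4 edges: its edges are {a, x_i, y_i}, {a, z_i, w_i}, {b, x_i, w_i}, {b, y_i, z_i}, {c, x_i, z_i}, {c, y_i, w_i} for i = 1, …, k. -/
/-- The vertex set of the construction: `Sum.inl 0/1/2` are `a`, `b`, `c`, and
`Sum.inr (i, 0/1/2/3)` are `xᵢ`, `yᵢ`, `zᵢ`, `wᵢ`. It has `4k + 3` elements. -/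
abbrev ConstructionVertex (k : ℕ) := Fin 3 ⊕ (Fin k × Fin 4)

/-- The edge set of the lower-bound construction:
`{a,xᵢ,yᵢ}, {a,zᵢ,wᵢ}, {b,xᵢ,wᵢ}, {b,yᵢ,zᵢ}, {c,xᵢ,zᵢ}, {c,yᵢ,wᵢ}` for `i = 1,…,k`. -/
def constructionEdges (k : ℕ) : Finset (Finset (ConstructionVertex k)) :=
  Finset.univ.biUnion (fun i : Fin k =>
    ({ {Sum.inl 0, Sum.inr (i, 0), Sum.inr (i, 1)},
       {Sum.inl 0, Sum.inr (i, 2), Sum.inr (i, 3)},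
       {Sum.inl 1, Sum.inr (i, 0), Sum.inr (i, 3)},
       {Sum.inl 1, Sum.inr (i, 1), Sum.inr (i, 2)},
       {Sum.inl 2, Sum.inr (i, 0), Sum.inr (i, 2)},
       {Sum.inl 2, Sum.inr (i, 1), Sum.inr (i, 3)} } : Finset (Finset (ConstructionVertex k))))

/-- The six triples of a single gadget, on `a, b, c` and `x, y, z, w`. -/
def gadgetTriple : Fin 6 → Finset (Fin 3 ⊕ Fin 4) :=
  ![{Sum.inl 0, Sum.inr 0, Sum.inr 1},
    {Sum.inl 0, Sum.inr 2, Sum.inr 3},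
    {Sum.inl 1, Sum.inr 0, Sum.inr 3},
    {Sum.inl 1, Sum.inr 1, Sum.inr 2},
    {Sum.inl 2, Sum.inr 0, Sum.inr 2},
    {Sum.inl 2, Sum.inr 1, Sum.inr 3}]

/-- The index of the vertex among `a, b, c` lying on a given triple of the gadget. -/
def gadgetApex : Fin 6 → Fin 3 := ![0, 0, 1, 1, 2, 2]

/-- The embedding of the gadget as the `i`-th gadget of the construction. -/
def gadgetEmbedding {k : ℕ} (i : Fin k) : Fin 3 ⊕ Fin 4 ↪ ConstructionVertex k :=
  (Function.Embedding.refl _).sumMap ⟨Prod.mk i, Prod.mk_right_injective i⟩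

/-- The `s`-th edge of the `i`-th gadget. -/
def gadgetEdge {k : ℕ} (i : Fin k) (s : Fin 6) : Finset (ConstructionVertex k) :=
  (gadgetTriple s).map (gadgetEmbedding i)

lemma card_gadgetTriple (s : Fin 6) : (gadgetTriple s).card = 3 := by
  decide +revert

lemma card_gadgetTriple_inter {s t : Fin 6} (h : s ≠ t) :
    (gadgetTriple s ∩ gadgetTriple t).card ≤ 1 := by
  decide +revert

lemma inl_mem_gadgetTriple {a : Fin 3} {s : Fin 6} :
    Sum.inl a ∈ gadgetTriple s ↔ a = gadgetApex s := by
  decide +revert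

lemma gadgetApex_eq_or_eq_of_disjoint {s t u : Fin 6}
    (htu : Disjoint (gadgetTriple t) (gadgetTriple u))
    (ht : (gadgetTriple s ∩ gadgetTriple t).Nonempty)
    (hu : (gadgetTriple s ∩ gadgetTriple u).Nonempty) :
    gadgetApex s = gadgetApex t ∨ gadgetApex s = gadgetApex u := by
  decide +revert

lemma inl_mem_gadgetEdge {k : ℕ} {i : Fin k} {s : Fin 6} {a : Fin 3} :
    Sum.inl a ∈ gadgetEdge i s ↔ a = gadgetApex s := by
  simp [gadgetEdge, gadgetEmbedding, ← inl_mem_gadgetTriple]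

lemma inr_mem_gadgetEdge {k : ℕ} {i j : Fin k} {s : Fin 6} {p : Fin 4} :
    Sum.inr (j, p) ∈ gadgetEdge i s ↔ i = j ∧ Sum.inr p ∈ gadgetTriple s := by
  simp only [gadgetEdge, gadgetEmbedding, Finset.mem_map]
  constructor
  · rintro ⟨v | v, hv, h⟩ <;> simp_all
  · rintro ⟨rfl, h⟩
    exact ⟨_, h, rfl⟩

lemma mem_constructionEdges {k : ℕ} {e : Finset (ConstructionVertex k)} :
    e ∈ constructionEdges k ↔ ∃ i s, gadgetEdge i s = e := by
  simp [constructionEdges, gadgetEdge, gadgetTriple, gadgetEmbedding, Fin.exists_fin_succ, eq_comm]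

lemma card_gadgetEdge {k : ℕ} (i : Fin k) (s : Fin 6) : (gadgetEdge i s).card = 3 := by
  rw [gadgetEdge, Finset.card_map, card_gadgetTriple]

lemma gadgetEdge_inter_gadgetEdge {k : ℕ} (i : Fin k) (s t : Fin 6) :
    gadgetEdge i s ∩ gadgetEdge i t =
      (gadgetTriple s ∩ gadgetTriple t).map (gadgetEmbedding i) :=
  (Finset.map_inter _ _).symm

/-- Edges of different gadgets can only meet in their apex. -/
lemma gadgetEdge_inter_subset {k : ℕ} {i j : Fin k} (h : i ≠ j) (s t : Fin 6) :
    gadgetEdge i s ∩ gadgetEdge j t ⊆ {Sum.inl (gadgetApex s)} := by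
  rintro (a | ⟨l, p⟩) hv <;>
    simp only [Finset.mem_inter, inl_mem_gadgetEdge, inr_mem_gadgetEdge] at hv
  · simp [hv.1]
  · exact absurd (hv.1.1.trans hv.2.1.symm) h

lemma card_gadgetEdge_inter {k : ℕ} {i j : Fin k} {s t : Fin 6} (h : (i, s) ≠ (j, t)) :
    (gadgetEdge i s ∩ gadgetEdge j t).card ≤ 1 := by
  obtain rfl | hij := eq_or_ne i j
  · rw [gadgetEdge_inter_gadgetEdge, Finset.card_map]
    exact card_gadgetTriple_inter fun hst => h (by rw [hst])
  · exact (Finset.card_le_card (gadgetEdge_inter_subset hij s t)).trans_eq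
      (Finset.card_singleton _)

lemma gadgetEdge_injective (k : ℕ) :
    Function.Injective fun x : Fin k × Fin 6 => gadgetEdge x.1 x.2 := by
  rintro ⟨i, s⟩ ⟨j, t⟩ (h : gadgetEdge i s = gadgetEdge j t)
  by_contra hne
  have hcard := card_gadgetEdge_inter hne
  rw [← h, Finset.inter_self, card_gadgetEdge] at hcard
  omega

lemma card_constructionEdges (k : ℕ) : (constructionEdges k).card = 6 * k := by
  have h : constructionEdges k =
      Finset.univ.image fun x : Fin k × Fin 6 => gadgetEdge x.1 x.2 := by
    ext e
    simp [mem_constructionEdges]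
  rw [h, Finset.card_image_of_injective _ (gadgetEdge_injective k)]
  simp [mul_comm]

lemma linearTripleSystem_constructionEdges (k : ℕ) :
    LinearTripleSystem (constructionEdges k) := by
  simp only [LinearTripleSystem, mem_constructionEdges]
  constructor
  · rintro _ ⟨i, s, rfl⟩
    exact card_gadgetEdge i s
  · rintro _ ⟨i, s, rfl⟩ _ ⟨j, t, rfl⟩ hne
    refine card_gadgetEdge_inter fun h => hne ?_
    obtain ⟨rfl, rfl⟩ := Prod.mk.inj h
    rfl

lemma gadgetApex_eq_of_inter_nonempty {k : ℕ} {i j : Fin k} {s t : Fin 6} (h : i ≠ j)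
    (hst : (gadgetEdge i s ∩ gadgetEdge j t).Nonempty) : gadgetApex s = gadgetApex t := by
  obtain ⟨v, hv⟩ := hst
  have hvs := Finset.mem_singleton.mp (gadgetEdge_inter_subset h s t hv)
  exact inl_mem_gadgetEdge.mp (hvs ▸ (Finset.mem_inter.mp hv).2)

/-- Of two disjoint edges meeting a given edge, one shares its apex. -/
lemma gadgetApex_eq_or_eq {k : ℕ} {i j l : Fin k} {s t u : Fin 6}
    (htu : Disjoint (gadgetEdge j t) (gadgetEdge l u))
    (ht : (gadgetEdge i s ∩ gadgetEdge j t).Nonempty)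
    (hu : (gadgetEdge i s ∩ gadgetEdge l u).Nonempty) :
    gadgetApex s = gadgetApex t ∨ gadgetApex s = gadgetApex u := by
  obtain rfl | hij := eq_or_ne i j
  · obtain rfl | hil := eq_or_ne i l
    · rw [gadgetEdge_inter_gadgetEdge, Finset.map_nonempty] at ht hu
      exact gadgetApex_eq_or_eq_of_disjoint ((Finset.disjoint_map _).mp htu) ht hu
    · exact Or.inr (gadgetApex_eq_of_inter_nonempty hil hu)
  · exact Or.inl (gadgetApex_eq_of_inter_nonempty hij ht)

lemma gadgetApex_ne_of_disjoint {k : ℕ} {i j : Fin k} {s t : Fin 6}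
    (h : Disjoint (gadgetEdge i s) (gadgetEdge j t)) : gadgetApex s ≠ gadgetApex t := fun hst =>
  Finset.disjoint_left.mp h (inl_mem_gadgetEdge.mpr rfl) (inl_mem_gadgetEdge.mpr hst)

lemma not_hasCrown_constructionEdges (k : ℕ) : ¬ HasCrown (constructionEdges k) := by
  simp only [HasCrown, mem_constructionEdges]
  rintro ⟨_, ⟨i, s, rfl⟩, _, ⟨i₁, s₁, rfl⟩, _, ⟨i₂, s₂, rfl⟩, _, ⟨i₃, s₃, rfl⟩,
    h₁₂, h₁₃, h₂₃, h₁, h₂, h₃⟩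
  have := gadgetApex_ne_of_disjoint h₁₂
  have := gadgetApex_ne_of_disjoint h₁₃
  have := gadgetApex_ne_of_disjoint h₂₃
  have := gadgetApex_eq_or_eq h₁₂ h₁ h₂
  have := gadgetApex_eq_or_eq h₁₃ h₁ h₃
  have := gadgetApex_eq_or_eq h₂₃ h₂ h₃
  grind

/-- For every `k ≥ 1`, the construction above is a crown-free linear 3-graph on
`n = 4k + 3` vertices with exactly `6k = 6(n-3)/4` edges. -/
theorem construction_crown_free (k : ℕ) (hk : 1 ≤ k) :
    Fintype.card (ConstructionVertex k) = 4 * k + 3 ∧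
    LinearTripleSystem (constructionEdges k) ∧
    ¬ HasCrown (constructionEdges k) ∧
    (constructionEdges k).card = 6 * k := by
  refine ⟨?_, linearTripleSystem_constructionEdges k, not_hasCrown_constructionEdges k,
    card_constructionEdges k⟩
  simp only [Fintype.card_sum, Fintype.card_prod, Fintype.card_fin]
  omega
end
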